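/- Let 0 < α < n, let Φ, Ψ be Orlicz functions with Φ* ∈ Δ₂, and let either 0 < λ, μ < 1 with λ ≠ μ, or λ = μ = 0. Assume there exists a constant C₅ ≥ 1 such that ∫_u^∞ t^{α/n} Φ⁻¹(r^λ/t) dt/t ≤ C₅ Ψ⁻¹(r^μ/u) for all u > 0 and all r > 0. Then there exists a constant C₇ ≥ 1 such that for all f ∈ M^{Φ,λ}(0) with f ≠ 0 and all r > 0, ∫_{B_r} Ψ( (∫_{B_{2r}} |f(y)| |x−y|^{α−n} dy) / (C₇ ‖f‖_{M^{Φ,λ}(0)}) ) dx ≤ |B_r|^μ. -/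

import Mathlib

open MeasureTheory Metric Set Filter ENNReal NNReal Topology

noncomputable section

/-- ℝⁿ as Euclidean space. -/
abbrev Eu (n : ℕ) : Type := EuclideanSpace ℝ (Fin n)

/-- The (right-continuous) generalized inverse `Φ⁻¹(v) = inf {u ≥ 0 : Φ(u) > v}`
(with `inf ∅ = ∞`). -/
def yInv (Φ : ℝ≥0∞ → ℝ≥0∞) (v : ℝ≥0∞) : ℝ≥0∞ := sInf {u : ℝ≥0∞ | v < Φ u}

/-- The complementary (conjugate) function `Φ*(v) = sup_{u > 0} (u⬝v − Φ(u))`. -/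
def yConj (Φ : ℝ≥0∞ → ℝ≥0∞) (v : ℝ≥0∞) : ℝ≥0∞ :=
  ⨆ (u : ℝ≥0∞) (_ : 0 < u) (_ : u ≠ ∞), u * v - Φ u

/-- The dilation function `s_{Φ⁻¹}(t) = sup_{s > 0} Φ⁻¹(st)/Φ⁻¹(s)`. -/
def sDil (Φ : ℝ≥0∞ → ℝ≥0∞) (t : ℝ≥0∞) : ℝ≥0∞ :=
  ⨆ (s : ℝ≥0∞) (_ : 0 < s) (_ : s ≠ ∞), yInv Φ (s * t) / yInv Φ s

/-- A Young function: nondecreasing, convex, `Φ(0) = 0 = lim_{u→0+} Φ(u)`, not identically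
`0` nor `∞` on `(0,∞)`, and left continuous (values in `[0,∞]`, the value at `∞` being the
canonical/limit extension). -/
structure IsYoungFn (Φ : ℝ≥0∞ → ℝ≥0∞) : Prop where
  mono : Monotone Φ
  map_zero : Φ 0 = 0
  tendsto_zero : Filter.Tendsto Φ (nhdsWithin 0 (Set.Ioi 0)) (nhds 0)
  convex : ∀ a b t : ℝ≥0∞, t ≤ 1 → Φ (t * a + (1 - t) * b) ≤ t * Φ a + (1 - t) * Φ b
  not_zero : ∃ u : ℝ≥0∞, 0 < u ∧ u ≠ ∞ ∧ Φ u ≠ 0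
  not_top : ∃ u : ℝ≥0∞, 0 < u ∧ u ≠ ∞ ∧ Φ u ≠ ∞
  left_cont : ∀ u : ℝ≥0∞, 0 < u → Filter.Tendsto Φ (nhdsWithin u (Set.Iio u)) (nhds (Φ u))

/-- An Orlicz function: increasing, continuous, convex, `Φ(0) = 0`, finite on `[0,∞)`
(the value at `∞` being the canonical extension `Φ(∞) = ∞`). -/
structure IsOrliczFn (Φ : ℝ≥0∞ → ℝ≥0∞) : Prop where
  map_zero : Φ 0 = 0
  strictMono : StrictMono Φ
  continuous : Continuous Φ
  convex : ∀ a b t : ℝ≥0∞, t ≤ 1 → Φ (t * a + (1 - t) * b) ≤ t * Φ a + (1 - t) * Φ b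
  finite : ∀ u : ℝ≥0∞, u ≠ ∞ → Φ u ≠ ∞
  map_top : Φ ∞ = ∞

/-- The Δ₂-condition: `0 < Φ(u) < ∞` for `0 < u < ∞` and `Φ(2u) ≤ D₂ Φ(u)` for some `D₂ ≥ 1`. -/
def IsDelta2 (Φ : ℝ≥0∞ → ℝ≥0∞) : Prop :=
  (∀ u : ℝ≥0∞, 0 < u → u ≠ ∞ → 0 < Φ u ∧ Φ u ≠ ∞) ∧
    ∃ D : ℝ≥0∞, 1 ≤ D ∧ D ≠ ∞ ∧ ∀ u : ℝ≥0∞, u ≠ ∞ → Φ (2 * u) ≤ D * Φ u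

/-- The Luxemburg-type functional `‖f‖_{Φ,λ,A}`. -/
def orliczNorm {n : ℕ} (Φ : ℝ≥0∞ → ℝ≥0∞) (lam : ℝ) (A : Set (Eu n)) (f : Eu n → ℝ) : ℝ≥0∞ :=
  sInf {ε : ℝ≥0∞ | 0 < ε ∧ ε ≠ ∞ ∧
    volume A ^ (-lam) * ∫⁻ x in A, Φ ((‖f x‖₊ : ℝ≥0∞) / ε) ≤ 1}

/-- The weak Luxemburg-type functional `‖f‖_{Φ,λ,A,∞}`. -/
def orliczWeakNorm {n : ℕ} (Φ : ℝ≥0∞ → ℝ≥0∞) (lam : ℝ) (A : Set (Eu n)) (f : Eu n → ℝ) : ℝ≥0∞ :=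
  sInf {ε : ℝ≥0∞ | 0 < ε ∧ ε ≠ ∞ ∧
    (⨆ (u : ℝ≥0) (_ : 0 < u),
      Φ ((u : ℝ≥0∞) / ε) * (volume A ^ (-lam) * volume {x ∈ A | u < ‖f x‖₊})) ≤ 1}

/-- The central Morrey–Orlicz norm `‖f‖_{M^{Φ,λ}(0)} = sup_{r>0} ‖f‖_{Φ,λ,B_r}`. -/
def centralNorm {n : ℕ} (Φ : ℝ≥0∞ → ℝ≥0∞) (lam : ℝ) (f : Eu n → ℝ) : ℝ≥0∞ :=
  ⨆ (r : ℝ) (_ : 0 < r), orliczNorm Φ lam (ball (0 : Eu n) r) f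

/-- The weak central Morrey–Orlicz norm `‖f‖_{WM^{Φ,λ}(0)} = sup_{r>0} ‖f‖_{Φ,λ,B_r,∞}`. -/
def centralWeakNorm {n : ℕ} (Φ : ℝ≥0∞ → ℝ≥0∞) (lam : ℝ) (f : Eu n → ℝ) : ℝ≥0∞ :=
  ⨆ (r : ℝ) (_ : 0 < r), orliczWeakNorm Φ lam (ball (0 : Eu n) r) f

/-- The Riesz potential `I_α f(x) = ∫ f(y) |x−y|^{α−n} dy`. -/
def riesz {n : ℕ} (α : ℝ) (f : Eu n → ℝ) (x : Eu n) : ℝ :=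
  ∫ y, f y / ‖x - y‖ ^ ((n : ℝ) - α)

/-- The classical Morrey norm `‖f‖_{M^{p,λ}}`. -/
def morreyNormP {n : ℕ} (p lam : ℝ) (f : Eu n → ℝ) : ℝ≥0∞ :=
  ⨆ (x₀ : Eu n) (r : ℝ) (_ : 0 < r),
    (volume (ball x₀ r) ^ (-lam) * ∫⁻ x in ball x₀ r, (‖f x‖₊ : ℝ≥0∞) ^ p) ^ (1 / p)

/-- The classical central Morrey norm `‖f‖_{M^{p,λ}(0)}`. -/
def centralNormP {n : ℕ} (p lam : ℝ) (f : Eu n → ℝ) : ℝ≥0∞ :=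
  ⨆ (r : ℝ) (_ : 0 < r),
    (volume (ball (0 : Eu n) r) ^ (-lam) * ∫⁻ x in ball (0 : Eu n) r, (‖f x‖₊ : ℝ≥0∞) ^ p) ^ (1 / p)

namespace IsOrliczFn

variable {Φ : ℝ≥0∞ → ℝ≥0∞}

lemma map_mul_le (hΦ : IsOrliczFn Φ) {t : ℝ≥0∞} (ht : t ≤ 1) (a : ℝ≥0∞) :
    Φ (t * a) ≤ t * Φ a := by
  simpa [hΦ.map_zero] using hΦ.convex a 0 t ht

lemma map_div_le (hΦ : IsOrliczFn Φ) {c : ℝ≥0∞} (hc : 1 ≤ c) (a : ℝ≥0∞) :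
    Φ (a / c) ≤ Φ a / c := by
  simpa only [ENNReal.div_eq_inv_mul] using hΦ.map_mul_le (ENNReal.inv_le_one.2 hc) a

lemma mul_map_le (hΦ : IsOrliczFn Φ) {u w : ℝ≥0∞} (huw : u ≤ w) (hw : w ≠ ∞) :
    w * Φ u ≤ u * Φ w := by
  rcases eq_or_ne w 0 with rfl | hw0
  · simp
  have h := hΦ.map_mul_le (ENNReal.div_le_of_le_mul (by simpa using huw) : u / w ≤ 1) w
  rw [ENNReal.div_mul_cancel hw0 hw] at h
  calc w * Φ u ≤ w * (u / w * Φ w) := by gcongr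
    _ = u * Φ w := by rw [← mul_assoc, ENNReal.mul_div_cancel hw0 hw]

lemma pos (hΦ : IsOrliczFn Φ) {u : ℝ≥0∞} (hu : u ≠ 0) : Φ u ≠ 0 := by
  have := hΦ.strictMono (pos_iff_ne_zero.2 hu)
  rw [hΦ.map_zero] at this
  exact this.ne'

lemma surjective (hΦ : IsOrliczFn Φ) : Function.Surjective Φ := fun w =>
  mem_range_of_exists_le_of_exists_ge hΦ.continuous ⟨0, by simp [hΦ.map_zero]⟩
    ⟨∞, by simp [hΦ.map_top]⟩

lemma yInv_map (hΦ : IsOrliczFn Φ) (a : ℝ≥0∞) : yInv Φ (Φ a) = a := by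
  have h : {u : ℝ≥0∞ | Φ a < Φ u} = Ioi a := by
    ext u
    simp [hΦ.strictMono.lt_iff_lt]
  rw [yInv, h]
  exact le_antisymm (le_of_forall_gt_imp_ge_of_dense fun b hb => sInf_le hb)
    (le_sInf fun b hb => le_of_lt hb)

lemma map_yInv (hΦ : IsOrliczFn Φ) (w : ℝ≥0∞) : Φ (yInv Φ w) = w := by
  obtain ⟨a, rfl⟩ := hΦ.surjective w
  rw [hΦ.yInv_map]

lemma yInv_ne_top (hΦ : IsOrliczFn Φ) {w : ℝ≥0∞} (hw : w ≠ ∞) : yInv Φ w ≠ ∞ := by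
  intro h
  apply hw
  rw [← hΦ.map_yInv w, h, hΦ.map_top]

lemma yInv_mono (hΦ : IsOrliczFn Φ) : Monotone (yInv Φ) := fun v w h => by
  rw [← hΦ.strictMono.le_iff_le, hΦ.map_yInv, hΦ.map_yInv]
  exact h

lemma yInv_le_mul_yInv_div (hΦ : IsOrliczFn Φ) {c : ℝ≥0∞} (hc : 1 ≤ c) (hct : c ≠ ∞)
    (w : ℝ≥0∞) : yInv Φ w ≤ c * yInv Φ (w / c) := by
  have h : yInv Φ w / c ≤ yInv Φ (w / c) := by
    rw [← hΦ.strictMono.le_iff_le, hΦ.map_yInv]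
    simpa only [hΦ.map_yInv] using hΦ.map_div_le hc (yInv Φ w)
  have hc0 : c ≠ 0 := (zero_lt_one.trans_le hc).ne'
  rwa [ENNReal.div_le_iff hc0 hct, mul_comm] at h

lemma yConj_map_div_le (hΦ : IsOrliczFn Φ) (u : ℝ≥0∞) :
    yConj Φ (Φ u / u) ≤ Φ u := by
  refine iSup_le fun w => iSup_le fun _ => iSup_le fun hw => tsub_le_iff_right.2 ?_
  rw [← mul_div_assoc]
  refine ENNReal.div_le_of_le_mul ?_
  rcases le_total w u with h | h
  · calc w * Φ u ≤ Φ u * u := by rw [mul_comm]; gcongr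
      _ ≤ _ := by gcongr; exact le_self_add
  · calc w * Φ u ≤ u * Φ w := hΦ.mul_map_le h hw
      _ ≤ _ := by rw [mul_comm]; gcongr; exact le_add_self

/-- The `∇₂`-condition for `Φ`, obtained from the `Δ₂`-condition for its complementary function. -/
lemma exists_nabla_two (hΦ : IsOrliczFn Φ) (hΔ : IsDelta2 (yConj Φ)) :
    ∃ k : ℝ≥0, 2 ≤ k ∧ ∀ u : ℝ≥0∞, 2 * (k : ℝ≥0∞) * Φ u ≤ Φ (k * u) := by
  obtain ⟨-, D, -, hDt, hD⟩ := hΔ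
  lift D to ℝ≥0 using hDt
  refine ⟨D ^ 2 + 2, le_add_self, fun u => ?_⟩
  set k : ℝ≥0 := D ^ 2 + 2 with hk
  have hk0 : (k : ℝ≥0∞) ≠ 0 := by simp [hk]
  rcases eq_or_ne u 0 with rfl | hu
  · simp [hΦ.map_zero]
  rcases eq_or_ne u ∞ with rfl | hut
  · simp [ENNReal.mul_top hk0, hΦ.map_top]
  have hp : Φ u ≠ ∞ := hΦ.finite u hut
  set p := Φ u with hpdef
  have hv : p / u ≠ ∞ := ENNReal.div_ne_top hp hu
  have h1 : yConj Φ (2 * (2 * (p / u))) ≤ D * (D * p) :=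
    (hD _ (ENNReal.mul_ne_top (by simp) hv)).trans <| by
      gcongr
      exact (hD _ hv).trans <| by gcongr; exact hΦ.yConj_map_div_le u
  have hku : (k : ℝ≥0∞) * u ≠ 0 := mul_ne_zero hk0 hu
  have hkut : (k : ℝ≥0∞) * u ≠ ∞ := ENNReal.mul_ne_top (by simp) hut
  have h2 : (k * u) * (2 * (2 * (p / u))) - Φ (k * u) ≤ D * (D * p) := by
    refine le_trans ?_ h1
    refine le_iSup_of_le (k * u) (le_iSup_of_le (pos_iff_ne_zero.2 hku) ?_)
    exact le_iSup (fun _ : (k : ℝ≥0∞) * u ≠ ∞ => _) hkut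
  have h3 := tsub_le_iff_right.1 h2
  have h4 : (k : ℝ≥0∞) * u * (2 * (2 * (p / u))) = 2 * k * p + 2 * k * p := by
    calc (k : ℝ≥0∞) * u * (2 * (2 * (p / u))) = k * 2 * 2 * (u * (p / u)) := by ring
      _ = _ := by rw [ENNReal.mul_div_cancel hu hut]; ring
  have h5 : (D : ℝ≥0∞) * (D * p) ≤ 2 * k * p := by
    rw [← mul_assoc]
    refine mul_le_mul' ?_ le_rfl
    norm_cast
    rw [hk]
    nlinarith [sq_nonneg D]
  rw [h4] at h3
  have h6 : 2 * (k : ℝ≥0∞) * p ≠ ∞ :=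
    ENNReal.mul_ne_top (ENNReal.mul_ne_top (by simp) (by simp)) hp
  exact (ENNReal.add_le_add_iff_left h6).1 (h3.trans (by gcongr))

/-- Summing `Φ` against the dyadic levels below `w` costs at most a constant under `∇₂`. -/
lemma tsum_levels_mul_le (hΦ : IsOrliczFn Φ) {k : ℝ≥0} (hk : 2 ≤ k)
    (hk2 : ∀ u : ℝ≥0∞, 2 * (k : ℝ≥0∞) * Φ u ≤ Φ (k * u)) (w : ℝ≥0∞) :
    (∑' j : ℤ, if (k : ℝ≥0∞) ^ j < w then Φ ((k : ℝ≥0∞) ^ (j + 1)) / (k : ℝ≥0∞) ^ j else 0) * w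
      ≤ 2 * Φ (k * w) := by
  have hk0 : (k : ℝ≥0∞) ≠ 0 := by
    have : k ≠ 0 := (zero_lt_two.trans_le hk).ne'
    simpa using this
  have hkt : (k : ℝ≥0∞) ≠ ∞ := by simp
  have hk1 : (1 : ℝ≥0∞) < k := by
    have : (1 : ℝ≥0) < k := one_lt_two.trans_le hk
    exact_mod_cast this
  rcases eq_or_ne w 0 with rfl | hw
  · simp
  rcases eq_or_ne w ∞ with rfl | hwt
  · simp [ENNReal.mul_top hk0, hΦ.map_top]
  obtain ⟨J, hJ1, hJ2⟩ := ENNReal.exists_mem_Ioc_zpow hw hwt hk1 hkt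
  have hz0 : ∀ j : ℤ, (k : ℝ≥0∞) ^ j ≠ 0 := fun j => (ENNReal.zpow_pos hk0 hkt j).ne'
  have hzt : ∀ j : ℤ, (k : ℝ≥0∞) ^ j ≠ ∞ := fun j => (ENNReal.zpow_lt_top hk0 hkt j).ne
  have hzs : ∀ j : ℤ, (k : ℝ≥0∞) ^ (j + 1) = k * (k : ℝ≥0∞) ^ j := fun j => by
    rw [ENNReal.zpow_add hk0 hkt, zpow_one, mul_comm]
  set a : ℤ → ℝ≥0∞ := fun j => Φ ((k : ℝ≥0∞) ^ (j + 1)) / (k : ℝ≥0∞) ^ j with ha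
  have hstep : ∀ j, a j ≤ 2⁻¹ * a (j + 1) := fun j => by
    simp only [ha]
    have h := hk2 ((k : ℝ≥0∞) ^ (j + 1))
    rw [← hzs] at h
    refine ENNReal.div_le_of_le_mul ?_
    have h2 : (2 : ℝ≥0∞) * k ≠ 0 := mul_ne_zero two_ne_zero hk0
    have h2t : (2 : ℝ≥0∞) * k ≠ ∞ := ENNReal.mul_ne_top (by simp) hkt
    rw [mul_comm, ← ENNReal.le_div_iff_mul_le (Or.inl h2) (Or.inl h2t)] at h
    refine h.trans (le_of_eq ?_)
    rw [hzs j, ENNReal.div_eq_inv_mul, ENNReal.div_eq_inv_mul,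
      ENNReal.mul_inv (Or.inl two_ne_zero) (Or.inl (by simp)),
      ENNReal.mul_inv (Or.inl hk0) (Or.inl hkt)]
    calc 2⁻¹ * (k : ℝ≥0∞)⁻¹ * Φ ((k : ℝ≥0∞) ^ (j + 1 + 1))
        = 2⁻¹ * (k : ℝ≥0∞)⁻¹ * Φ ((k : ℝ≥0∞) ^ (j + 1 + 1)) * 1 := (mul_one _).symm
      _ = 2⁻¹ * (k : ℝ≥0∞)⁻¹ * Φ ((k : ℝ≥0∞) ^ (j + 1 + 1)) *
            (((k : ℝ≥0∞) ^ j)⁻¹ * (k : ℝ≥0∞) ^ j) := by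
          rw [ENNReal.inv_mul_cancel (hz0 j) (hzt j)]
      _ = _ := by ring
  have hgeom : ∀ i : ℕ, a (J - i) ≤ 2⁻¹ ^ i * a J := fun i => by
    induction i with
    | zero => simp
    | succ i ih =>
      refine (hstep _).trans ?_
      have : J - ((i + 1 : ℕ) : ℤ) + 1 = J - i := by push_cast; ring
      rw [this, pow_succ', mul_assoc]
      gcongr
  set F : ℤ → ℝ≥0∞ := fun j => if (k : ℝ≥0∞) ^ j < w then a j else 0 with hF
  have hsum : ∑' j, F j ≤ 2 * a J := by
    rw [← (Equiv.addLeft (J + 1)).tsum_eq F,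
      tsum_of_nat_of_neg_add_one ENNReal.summable ENNReal.summable]
    have h1 : ∀ i : ℕ, F (Equiv.addLeft (J + 1) (i : ℤ)) = 0 := fun i => by
      simp only [hF, Equiv.coe_addLeft]
      rw [if_neg]
      refine not_lt.2 (hJ2.trans ?_)
      exact ENNReal.zpow_le_of_le hk1.le (by lia)
    have h2 : ∀ i : ℕ, F (Equiv.addLeft (J + 1) (-((i : ℤ) + 1))) ≤ 2⁻¹ ^ i * a J := fun i => by
      have h3 : Equiv.addLeft (J + 1) (-((i : ℤ) + 1)) = J - i := by
        simp only [Equiv.coe_addLeft]; ring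
      rw [h3]
      refine le_trans ?_ (hgeom i)
      simp only [hF]
      split_ifs <;> simp
    simp only [h1, tsum_zero, zero_add]
    refine (ENNReal.tsum_le_tsum h2).trans (le_of_eq ?_)
    rw [ENNReal.tsum_mul_right, ENNReal.tsum_geometric, ENNReal.one_sub_inv_two, inv_inv]
  calc (∑' j, F j) * w ≤ 2 * a J * w := by gcongr
    _ = 2 * (w * Φ ((k : ℝ≥0∞) ^ (J + 1)) / (k : ℝ≥0∞) ^ J) := by
        simp only [ha, ENNReal.div_eq_inv_mul]; ring
    _ ≤ 2 * Φ (k * w) := by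
        gcongr
        refine ENNReal.div_le_of_le_mul ?_
        have h := hΦ.mul_map_le (u := (k : ℝ≥0∞) ^ (J + 1)) (w := k * w)
          (by rw [hzs]; gcongr) (ENNReal.mul_ne_top hkt hwt)
        rw [hzs J] at h ⊢
        rw [mul_assoc, mul_assoc, ENNReal.mul_le_mul_iff_right hk0 hkt] at h
        rwa [mul_comm (Φ _)]

end IsOrliczFn

lemma Eu.volume_closedBall {n : ℕ} (x : Eu n) {r : ℝ} (hr : 0 ≤ r) :
    volume (closedBall x r) = ENNReal.ofReal (r ^ n) * volume (ball (0 : Eu n) 1) := by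
  simpa using Measure.addHaar_closedBall (volume : Measure (Eu n)) x hr

/-- The superlevel set at height `s` of the centered Hardy–Littlewood maximal function of `G`. -/
def maximalLevelSet {n : ℕ} (G : Eu n → ℝ≥0∞) (s : ℝ≥0∞) : Set (Eu n) :=
  {x | ∃ ρ : ℝ, 0 < ρ ∧ s * volume (closedBall x ρ) < ∫⁻ y in closedBall x ρ, G y}

/-- The weak type `(1,1)` inequality for the centered Hardy–Littlewood maximal function. -/
lemma mul_volume_maximalLevelSet_le {n : ℕ} (hn : n ≠ 0) {G : Eu n → ℝ≥0∞}
    (hG : ∫⁻ y, G y ≠ ∞) {s : ℝ≥0∞} (hs : s ≠ 0) (hst : s ≠ ∞) :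
    s * volume (maximalLevelSet G s) ≤ 5 ^ n * ∫⁻ y, G y := by
  choose! ρ hρ hρG using fun x (hx : x ∈ maximalLevelSet G s) => hx
  set V : ℝ≥0∞ := volume (ball (0 : Eu n) 1) with hV
  have hV0 : V ≠ 0 := (measure_ball_pos volume _ one_pos).ne'
  have hVt : V ≠ ∞ := measure_ball_lt_top.ne
  have hbdd : ∀ x ∈ maximalLevelSet G s, ρ x ≤ max 1 ((∫⁻ y, G y) / (s * V)).toReal := by
    intro x hx
    rcases le_total (ρ x) 1 with h | h
    · exact le_max_of_le_left h
    refine le_max_of_le_right ?_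
    have h1 := (hρG x hx).le.trans (setLIntegral_le_lintegral _ _)
    rw [Eu.volume_closedBall x (hρ x hx).le, mul_left_comm] at h1
    have h2 : ENNReal.ofReal (ρ x ^ n) ≤ (∫⁻ y, G y) / (s * V) :=
      (ENNReal.le_div_iff_mul_le (Or.inl (mul_ne_zero hs hV0))
        (Or.inl (ENNReal.mul_ne_top hst hVt))).2 h1
    rw [ENNReal.ofReal_le_iff_le_toReal
      (ENNReal.div_ne_top hG (mul_ne_zero hs hV0))] at h2
    exact (le_self_pow₀ h hn).trans h2
  obtain ⟨u, hu, hdisj, hcov⟩ := Vitali.exists_disjoint_subfamily_covering_enlargement_closedBall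
    (maximalLevelSet G s) id ρ _ hbdd 5 (by norm_num)
  simp only [id] at hdisj hcov
  have hcount : u.Countable := hdisj.countable_of_nonempty_interior fun x hx =>
    ⟨x, ball_subset_interior_closedBall (mem_ball_self (hρ x (hu hx)))⟩
  have hsub : maximalLevelSet G s ⊆ ⋃ x ∈ u, closedBall x (5 * ρ x) := fun x hx => by
    obtain ⟨b, hb, hxb⟩ := hcov x hx
    exact mem_biUnion hb (hxb (mem_closedBall_self (hρ x hx).le))
  calc s * volume (maximalLevelSet G s)
      ≤ s * ∑' x : u, volume (closedBall (x : Eu n) (5 * ρ x)) := by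
        gcongr
        exact (measure_mono hsub).trans (measure_biUnion_le _ hcount _)
    _ = ∑' x : u, s * volume (closedBall (x : Eu n) (5 * ρ x)) := ENNReal.tsum_mul_left.symm
    _ ≤ ∑' x : u, 5 ^ n * ∫⁻ y in closedBall (x : Eu n) (ρ x), G y := by
        refine ENNReal.tsum_le_tsum fun x => ?_
        have hx := hρ x (hu x.2)
        have h := (hρG x (hu x.2)).le
        rw [Eu.volume_closedBall _ hx.le] at h
        rw [Eu.volume_closedBall _ (by positivity), mul_pow,
          ENNReal.ofReal_mul (by positivity), ENNReal.ofReal_pow (by norm_num)]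
        calc _ = 5 ^ n * (s * (ENNReal.ofReal (ρ x ^ n) * V)) := by
              rw [ENNReal.ofReal_ofNat]; ring
          _ ≤ _ := by gcongr
    _ = 5 ^ n * ∫⁻ y in ⋃ x ∈ u, closedBall x (ρ x), G y := by
        rw [ENNReal.tsum_mul_left,
          lintegral_biUnion hcount (fun _ _ => isClosed_closedBall.measurableSet) hdisj]
    _ ≤ 5 ^ n * ∫⁻ y, G y := by
        exact mul_le_mul' le_rfl (setLIntegral_le_lintegral _ _)

/-- A weak type inequality for the maximal function that only sees the large values of `G`. -/
lemma mul_volume_maximalLevelSet_le_truncated {n : ℕ} (hn : n ≠ 0) {G : Eu n → ℝ≥0∞}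
    (hGm : AEMeasurable G) (hG : ∫⁻ y, G y ≠ ∞) {s : ℝ≥0∞} (hs : s ≠ 0) (hst : s ≠ ∞) :
    s * volume (maximalLevelSet G s) ≤ 5 ^ n * ∫⁻ y, if s < 2 * G y then 2 * G y else 0 := by
  set H : Eu n → ℝ≥0∞ := fun y => if s < 2 * G y then 2 * G y else 0 with hH
  have hle : ∀ y, 2 * G y ≤ H y + s := fun y => by
    simp only [hH]
    split_ifs with h
    · exact le_self_add
    · simpa using h
  have hHt : ∫⁻ y, H y ≠ ∞ := by
    refine ne_top_of_le_ne_top (ENNReal.mul_ne_top (by simp : (2 : ℝ≥0∞) ≠ ∞) hG) ?_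
    rw [← lintegral_const_mul'' _ hGm]
    refine lintegral_mono fun y => ?_
    simp only [hH]
    split_ifs <;> simp
  refine le_trans ?_ (mul_volume_maximalLevelSet_le hn hHt hs hst)
  gcongr
  rintro x ⟨ρ, hρ, h⟩
  refine ⟨ρ, hρ, ?_⟩
  have hvt : s * volume (closedBall x ρ) ≠ ∞ :=
    ENNReal.mul_ne_top hst measure_closedBall_lt_top.ne
  have h2 : 2 * ∫⁻ y in closedBall x ρ, G y ≤
      (∫⁻ y in closedBall x ρ, H y) + s * volume (closedBall x ρ) := by
    rw [← lintegral_const_mul'' _ hGm.restrict, ← setLIntegral_const,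
      ← lintegral_add_right _ measurable_const]
    exact lintegral_mono hle
  have h3 : s * volume (closedBall x ρ) + s * volume (closedBall x ρ) <
      (∫⁻ y in closedBall x ρ, H y) + s * volume (closedBall x ρ) := by
    refine lt_of_lt_of_le ?_ h2
    rw [two_mul]
    exact ENNReal.add_lt_add h h
  exact (ENNReal.add_lt_add_iff_right hvt).1 h3

/-- The Riesz kernel is dominated by a sum over dyadic balls of radii comparable to `δ`. -/
lemma riesz_kernel_le_tsum {n : ℕ} {α δ : ℝ} (hαn : α < n) (hδ : 0 < δ) (x y : Eu n) :
    ENNReal.ofReal (‖x - y‖ ^ (α - n)) ≤ ∑' m : ℤ, (closedBall x (2 ^ (m + 1) * δ)).indicator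
      (fun _ => ENNReal.ofReal ((2 ^ m * δ) ^ (α - n))) y := by
  rcases eq_or_ne x y with rfl | hxy
  · simp [Real.zero_rpow (sub_ne_zero.2 hαn.ne)]
  have hpos : 0 < ‖x - y‖ := norm_pos_iff.2 (sub_ne_zero.2 hxy)
  obtain ⟨m, hm1, hm2⟩ := _root_.exists_mem_Ico_zpow (div_pos hpos hδ) (one_lt_two (α := ℝ))
  rw [le_div_iff₀ hδ] at hm1
  rw [div_lt_iff₀ hδ] at hm2
  refine le_trans ?_ (ENNReal.le_tsum m)
  rw [indicator_of_mem (by rw [mem_closedBall', dist_eq_norm]; exact hm2.le)]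
  exact ENNReal.ofReal_le_ofReal
    (Real.rpow_le_rpow_of_nonpos (by positivity) hm1 (by linarith))

lemma lintegral_riesz_le_tsum {n : ℕ} {α δ : ℝ} (hαn : α < n) (hδ : 0 < δ) {G : Eu n → ℝ≥0∞}
    (hG : AEMeasurable G) (x : Eu n) :
    ∫⁻ y, G y * ENNReal.ofReal (‖x - y‖ ^ (α - n)) ≤
      ∑' m : ℤ, ENNReal.ofReal ((2 ^ m * δ) ^ (α - n)) *
        ∫⁻ y in closedBall x (2 ^ (m + 1) * δ), G y := by
  have hm : ∀ m : ℤ, MeasurableSet (closedBall x (2 ^ (m + 1) * δ)) := fun m =>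
    isClosed_closedBall.measurableSet
  calc _ ≤ ∫⁻ y, ∑' m : ℤ, (closedBall x (2 ^ (m + 1) * δ)).indicator
        (fun y => ENNReal.ofReal ((2 ^ m * δ) ^ (α - n)) * G y) y := by
        refine lintegral_mono fun y => ?_
        refine (mul_le_mul' le_rfl (riesz_kernel_le_tsum hαn hδ x y)).trans (le_of_eq ?_)
        rw [← ENNReal.tsum_mul_left]
        refine tsum_congr fun m => ?_
        by_cases hy : y ∈ closedBall x (2 ^ (m + 1) * δ)
        · simpa [hy] using mul_comm _ _
        · simp [hy]
    _ = _ := by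
        rw [lintegral_tsum fun m => (hG.const_mul _).indicator (hm m)]
        refine tsum_congr fun m => ?_
        rw [lintegral_indicator (hm m), lintegral_const_mul'' _ hG.restrict]

/-- Passing from level-set bounds for the maximal function to an integral bound, for functions
`Φ` satisfying the `∇₂`-condition. -/
lemma IsOrliczFn.lintegral_le_of_le_off_maximalLevelSet {n : ℕ} (hn : n ≠ 0)
    {Φ : ℝ≥0∞ → ℝ≥0∞} (hΦ : IsOrliczFn Φ) {k : ℝ≥0} (hk : 2 ≤ k)
    (hk2 : ∀ u : ℝ≥0∞, 2 * (k : ℝ≥0∞) * Φ u ≤ Φ (k * u))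
    {G : Eu n → ℝ≥0∞} (hGm : AEMeasurable G) (hG : ∫⁻ y, G y ≠ ∞)
    {F : Eu n → ℝ≥0∞} {c : ℝ≥0∞} (hc : c ≠ 0) (hct : c ≠ ∞)
    (hF : ∀ t, t ≠ 0 → t ≠ ∞ → ∀ x ∉ maximalLevelSet G t, F x ≤ c * Φ t) :
    ∫⁻ x, F x ≤ 2 * 5 ^ n * c * ∫⁻ y, Φ (k * (2 * G y)) := by
  have hk1 : (1 : ℝ≥0∞) < k := by
    have : (1 : ℝ≥0) < k := one_lt_two.trans_le hk
    exact_mod_cast this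
  have hk0 : (k : ℝ≥0∞) ≠ 0 := (zero_lt_one.trans hk1).ne'
  have hkt : (k : ℝ≥0∞) ≠ ∞ := by simp
  have hz0 : ∀ j : ℤ, (k : ℝ≥0∞) ^ j ≠ 0 := fun j => (ENNReal.zpow_pos hk0 hkt j).ne'
  have hzt : ∀ j : ℤ, (k : ℝ≥0∞) ^ j ≠ ∞ := fun j => (ENNReal.zpow_lt_top hk0 hkt j).ne
  set E : ℤ → Set (Eu n) := fun j => maximalLevelSet G ((k : ℝ≥0∞) ^ j) with hE
  have hanti : ∀ {i j : ℤ}, i ≤ j → E j ⊆ E i := fun {i j} hij x ⟨ρ, hρ, h⟩ =>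
    ⟨ρ, hρ, lt_of_le_of_lt (mul_le_mul' (ENNReal.zpow_le_of_le hk1.le hij) le_rfl) h⟩
  have hEF : ∀ j, ∀ x ∉ E j, F x ≤ c * Φ ((k : ℝ≥0∞) ^ j) := fun j =>
    hF _ (hz0 j) (hzt j)
  set T : Eu n → ℝ≥0∞ := fun x => ∑' j : ℤ,
    (toMeasurable volume (E j)).indicator (fun _ => c * Φ ((k : ℝ≥0∞) ^ (j + 1))) x with hT
  have hterm : ∀ j, ∀ x ∈ E j, c * Φ ((k : ℝ≥0∞) ^ (j + 1)) ≤ T x := fun j x hx => by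
    refine le_trans ?_ (ENNReal.le_tsum j)
    rw [indicator_of_mem (subset_toMeasurable _ _ hx)]
  have hFT : ∀ x, F x ≤ T x := by
    intro x
    by_cases hall : ∀ j, x ∈ E j
    · have h1 : Tendsto (fun i : ℕ => c * Φ ((k : ℝ≥0∞) ^ i)) atTop (𝓝 (c * Φ ∞)) :=
        ENNReal.Tendsto.const_mul ((hΦ.continuous.tendsto ∞).comp
          (ENNReal.tendsto_pow_atTop_nhds_top_iff.2 hk1)) (Or.inr hct)
      have h2 : c * Φ ∞ ≤ T x := le_of_tendsto' h1 fun i => by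
        have := hterm ((i : ℤ) - 1) x (hall _)
        rwa [sub_add_cancel, zpow_natCast] at this
      rw [hΦ.map_top, ENNReal.mul_top hc] at h2
      exact le_top.trans h2
    by_cases hnone : ∀ j, x ∉ E j
    · have h1 : Tendsto (fun i : ℕ => c * Φ ((k : ℝ≥0∞)⁻¹ ^ i)) atTop (𝓝 (c * Φ 0)) :=
        ENNReal.Tendsto.const_mul ((hΦ.continuous.tendsto 0).comp
          (ENNReal.tendsto_pow_atTop_nhds_zero_of_lt_one (ENNReal.inv_lt_one.2 hk1)))
          (Or.inr hct)
      have h2 : F x ≤ c * Φ 0 := ge_of_tendsto' h1 fun i => by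
        have := hEF (-(i : ℤ)) x (hnone _)
        rwa [ENNReal.zpow_neg, zpow_natCast, ENNReal.inv_pow] at this
      rw [hΦ.map_zero, mul_zero] at h2
      exact h2.trans zero_le
    push Not at hall hnone
    obtain ⟨i, hi⟩ := hall
    obtain ⟨l, hl⟩ := hnone
    obtain ⟨j, hj, hj'⟩ : ∃ j, x ∈ E j ∧ x ∉ E (j + 1) := by
      by_contra! h
      have hup : ∀ j, l ≤ j → x ∈ E j := fun j hlj =>
        Int.leInduction (motive := fun j _ => x ∈ E j) hl (fun j _ hj => h j hj) j hlj
      exact hi (hanti (le_max_left i l) (hup _ (le_max_right i l)))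
    exact (hEF _ x hj').trans (hterm j x hj)
  have hmeas : ∀ j : ℤ, AEMeasurable (fun y =>
      Φ ((k : ℝ≥0∞) ^ (j + 1)) / (k : ℝ≥0∞) ^ j *
        if (k : ℝ≥0∞) ^ j < 2 * G y then 2 * G y else 0) := fun j => by
    have : Measurable fun u : ℝ≥0∞ => if (k : ℝ≥0∞) ^ j < u then u else 0 :=
      Measurable.ite measurableSet_Ioi measurable_id measurable_const
    exact (this.comp_aemeasurable (hGm.const_mul 2)).const_mul _
  calc ∫⁻ x, F x ≤ ∫⁻ x, T x := lintegral_mono hFT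
    _ = ∑' j : ℤ, c * Φ ((k : ℝ≥0∞) ^ (j + 1)) * volume (E j) := by
        rw [lintegral_tsum fun j => (measurable_const.indicator
          (measurableSet_toMeasurable _ _)).aemeasurable]
        refine tsum_congr fun j => ?_
        rw [lintegral_indicator (measurableSet_toMeasurable _ _), setLIntegral_const,
          measure_toMeasurable]
    _ ≤ ∑' j : ℤ, 5 ^ n * c * ∫⁻ y, Φ ((k : ℝ≥0∞) ^ (j + 1)) / (k : ℝ≥0∞) ^ j *
          if (k : ℝ≥0∞) ^ j < 2 * G y then 2 * G y else 0 := by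
        refine ENNReal.tsum_le_tsum fun j => ?_
        have hfin : Φ ((k : ℝ≥0∞) ^ (j + 1)) / (k : ℝ≥0∞) ^ j ≠ ∞ :=
          ENNReal.div_ne_top (hΦ.finite _ (hzt _)) (hz0 j)
        rw [lintegral_const_mul' _ _ hfin]
        have h := mul_volume_maximalLevelSet_le_truncated hn hGm hG (hz0 j) (hzt j)
        calc c * Φ ((k : ℝ≥0∞) ^ (j + 1)) * volume (E j)
            = c * (Φ ((k : ℝ≥0∞) ^ (j + 1)) / (k : ℝ≥0∞) ^ j) *
                ((k : ℝ≥0∞) ^ j * volume (E j)) := by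
              rw [← mul_assoc, mul_assoc c (_ / _), ENNReal.div_mul_cancel (hz0 j) (hzt j)]
          _ ≤ c * (Φ ((k : ℝ≥0∞) ^ (j + 1)) / (k : ℝ≥0∞) ^ j) * _ := mul_le_mul' le_rfl h
          _ = _ := by ring
    _ = 5 ^ n * c * ∫⁻ y, (∑' j : ℤ, if (k : ℝ≥0∞) ^ j < 2 * G y then
          Φ ((k : ℝ≥0∞) ^ (j + 1)) / (k : ℝ≥0∞) ^ j else 0) * (2 * G y) := by
        rw [ENNReal.tsum_mul_left, ← lintegral_tsum hmeas]
        congr 2 with y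
        rw [← ENNReal.tsum_mul_right]
        refine tsum_congr fun j => ?_
        split_ifs <;> simp
    _ ≤ 5 ^ n * c * ∫⁻ y, 2 * Φ (k * (2 * G y)) :=
        mul_le_mul' le_rfl (lintegral_mono fun y => hΦ.tsum_levels_mul_le hk hk2 _)
    _ = 2 * 5 ^ n * c * ∫⁻ y, Φ (k * (2 * G y)) := by
        rw [lintegral_const_mul' _ _ (by simp)]
        ring

/-- A Jensen-type bound for the integral of `G` in terms of the Orlicz modular of `G`. -/
lemma IsOrliczFn.setLIntegral_le {n : ℕ} {Φ : ℝ≥0∞ → ℝ≥0∞} (hΦ : IsOrliczFn Φ)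
    {G : Eu n → ℝ≥0∞} {a : ℝ≥0∞} (ha : a ≠ 0) (hat : a ≠ ∞) {B : Set (Eu n)}
    (hB : ∫⁻ y, Φ (G y) ≤ Φ a * volume B) :
    ∫⁻ y in B, G y ≤ 2 * a * volume B := by
  have hp : Φ a ≠ 0 := hΦ.pos ha
  have hpt : Φ a ≠ ∞ := hΦ.finite a hat
  have hq : a / Φ a ≠ 0 := (ENNReal.div_pos ha hpt).ne'
  have hqt : a / Φ a ≠ ∞ := ENNReal.div_ne_top hat hp
  have hle : ∀ y, G y ≤ a + a / Φ a * Φ (G y) := fun y => by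
    rcases le_total (G y) a with h | h
    · exact h.trans le_self_add
    refine le_trans ?_ le_add_self
    rcases eq_or_ne (G y) ∞ with h' | h'
    · rw [h', hΦ.map_top, ENNReal.mul_top hq]
    · rw [← ENNReal.mul_div_right_comm, ENNReal.le_div_iff_mul_le (Or.inl hp) (Or.inl hpt)]
      exact hΦ.mul_map_le h h'
  calc ∫⁻ y in B, G y ≤ ∫⁻ y in B, (a + a / Φ a * Φ (G y)) := lintegral_mono hle
    _ = a * volume B + a / Φ a * ∫⁻ y in B, Φ (G y) := by
        rw [lintegral_add_left measurable_const, setLIntegral_const, lintegral_const_mul' _ _ hqt]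
    _ ≤ a * volume B + a / Φ a * (Φ a * volume B) := by
        gcongr
        exact (setLIntegral_le_lintegral _ _).trans hB
    _ = 2 * a * volume B := by
        rw [← mul_assoc (a / Φ a), ENNReal.div_mul_cancel hp hpt]
        ring

lemma mul_le_two_mul_lintegral_Ioc {p c u : ℝ} (hp : 0 ≤ p) (hc : 2 ≤ c) (hu : 0 < u)
    {A : ℝ → ℝ≥0∞} (hA : ∀ s s', 0 < s → s ≤ s' → A s' ≤ A s) :
    ENNReal.ofReal (u ^ p) * A (c * u) ≤
      2 * ∫⁻ s in Ioc u (c * u), ENNReal.ofReal (s ^ p) * A s / ENNReal.ofReal s := by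
  have hcu : 0 < c * u := by positivity
  have h0 : ENNReal.ofReal (c * u) ≠ 0 := by simpa using hcu
  have h1 : ENNReal.ofReal (u ^ p) * A (c * u) / ENNReal.ofReal (c * u) *
      ENNReal.ofReal (c * u - u) ≤
      ∫⁻ s in Ioc u (c * u), ENNReal.ofReal (s ^ p) * A s / ENNReal.ofReal s := by
    rw [← Real.volume_Ioc, ← setLIntegral_const]
    refine setLIntegral_mono' measurableSet_Ioc fun s hs => ?_
    have hs0 : 0 < s := hu.trans hs.1
    refine ENNReal.div_le_div (mul_le_mul' (ENNReal.ofReal_le_ofReal ?_) (hA _ _ hs0 hs.2))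
      (ENNReal.ofReal_le_ofReal hs.2)
    exact Real.rpow_le_rpow hu.le hs.1.le hp
  have h2 : ENNReal.ofReal (c * u) ≤ 2 * ENNReal.ofReal (c * u - u) := by
    rw [← ENNReal.ofReal_ofNat, ← ENNReal.ofReal_mul (by norm_num)]
    exact ENNReal.ofReal_le_ofReal (by nlinarith)
  calc ENNReal.ofReal (u ^ p) * A (c * u)
      = ENNReal.ofReal (u ^ p) * A (c * u) / ENNReal.ofReal (c * u) * ENNReal.ofReal (c * u) :=
        (ENNReal.div_mul_cancel h0 ENNReal.ofReal_ne_top).symm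
    _ ≤ ENNReal.ofReal (u ^ p) * A (c * u) / ENNReal.ofReal (c * u) *
          (2 * ENNReal.ofReal (c * u - u)) := by gcongr
    _ ≤ _ := by
        rw [mul_left_comm]
        gcongr

lemma tsum_mul_le_two_mul_lintegral_Ioi {p c u : ℝ} (hp : 0 ≤ p) (hc : 2 ≤ c) (hu : 0 < u)
    {A : ℝ → ℝ≥0∞} (hA : ∀ s s', 0 < s → s ≤ s' → A s' ≤ A s) :
    ∑' m : ℕ, ENNReal.ofReal ((c ^ m * u) ^ p) * A (c * (c ^ m * u)) ≤
      2 * ∫⁻ s in Ioi u, ENNReal.ofReal (s ^ p) * A s / ENNReal.ofReal s := by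
  have hc1 : 1 ≤ c := by linarith
  have hmono : Monotone fun m : ℕ => c ^ m * u := fun i j hij => by
    dsimp only
    gcongr
  have hdisj : Pairwise (Function.onFun Disjoint
      fun m : ℕ => Ioc (c ^ m * u) (c ^ (m + 1) * u)) :=
    hmono.pairwise_disjoint_on_Ioc_succ
  calc _ ≤ ∑' m : ℕ, 2 * ∫⁻ s in Ioc (c ^ m * u) (c ^ (m + 1) * u),
        ENNReal.ofReal (s ^ p) * A s / ENNReal.ofReal s := by
        refine ENNReal.tsum_le_tsum fun m => ?_
        have h := mul_le_two_mul_lintegral_Ioc hp hc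
          (mul_pos (pow_pos (zero_lt_two.trans_le hc) m) hu) hA
        rwa [← mul_assoc c, ← pow_succ'] at h ⊢
    _ = 2 * ∫⁻ s in ⋃ m : ℕ, Ioc (c ^ m * u) (c ^ (m + 1) * u),
        ENNReal.ofReal (s ^ p) * A s / ENNReal.ofReal s := by
        rw [ENNReal.tsum_mul_left, lintegral_iUnion (fun _ => measurableSet_Ioc) hdisj]
    _ ≤ _ := by
        refine mul_le_mul' le_rfl (lintegral_mono_set ?_)
        refine iUnion_subset fun m s hs => ?_
        refine lt_of_le_of_lt ?_ hs.1
        exact le_mul_of_one_le_left hu.le (one_le_pow₀ hc1)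

/-- The volume of the unit ball, as a real number. -/
def unitBallVolume (n : ℕ) : ℝ := (volume (ball (0 : Eu n) 1)).toReal

lemma unitBallVolume_pos (n : ℕ) : 0 < unitBallVolume n :=
  ENNReal.toReal_pos (measure_ball_pos volume _ one_pos).ne' measure_ball_lt_top.ne

lemma Eu.volume_closedBall_eq_ofReal {n : ℕ} (x : Eu n) {r : ℝ} (hr : 0 ≤ r) :
    volume (closedBall x r) = ENNReal.ofReal (r ^ n * unitBallVolume n) := by
  rw [Eu.volume_closedBall x hr, ENNReal.ofReal_mul (by positivity), unitBallVolume,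
    ENNReal.ofReal_toReal measure_ball_lt_top.ne]

lemma ofReal_rpow_mul_volume_closedBall {n : ℕ} (hn : n ≠ 0) (α : ℝ) (x : Eu n) {d : ℝ}
    (hd : 0 < d) :
    ENNReal.ofReal (d ^ (α - n)) * volume (closedBall x (2 * d)) =
      ENNReal.ofReal (2 ^ n * unitBallVolume n ^ (1 - α / n)) *
        ENNReal.ofReal ((d ^ n * unitBallVolume n) ^ (α / n)) := by
  have hV := unitBallVolume_pos n
  have hn' : (n : ℝ) ≠ 0 := by exact_mod_cast hn
  rw [Eu.volume_closedBall_eq_ofReal x (by positivity), ← ENNReal.ofReal_mul (by positivity),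
    ← ENNReal.ofReal_mul (by positivity), Real.mul_rpow (by positivity) hV.le,
    ← Real.rpow_natCast d n, ← Real.rpow_mul hd.le, mul_div_cancel₀ _ hn',
    Real.rpow_sub hd, Real.rpow_sub hV, Real.rpow_one, mul_pow, Real.rpow_natCast]
  congr 1
  have h1 : unitBallVolume n ^ (α / n) ≠ 0 := (Real.rpow_pos_of_pos hV _).ne'
  field_simp

/-- Hedberg-type pointwise bound: where the maximal function of `G` does not exceed `t`, the
Riesz potential of `G` is controlled by a tail integral starting at `S / Φ t`. -/
lemma IsOrliczFn.exists_lintegral_riesz_le {n : ℕ} {α : ℝ} (hα : 0 < α) (hαn : α < n)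
    {Φ : ℝ≥0∞ → ℝ≥0∞} (hΦ : IsOrliczFn Φ) :
    ∃ C : ℝ≥0, 1 ≤ C ∧ ∀ S : ℝ, 0 < S → ∀ G : Eu n → ℝ≥0∞, AEMeasurable G →
      ∫⁻ y, Φ (G y) ≤ ENNReal.ofReal S → ∀ t : ℝ≥0∞, t ≠ 0 → t ≠ ∞ →
      ∀ x ∉ maximalLevelSet G t,
        ∫⁻ y, G y * ENNReal.ofReal (‖x - y‖ ^ (α - n)) ≤
          C * ∫⁻ s in Ioi (S / (Φ t).toReal),
            ENNReal.ofReal (s ^ (α / n)) * yInv Φ (ENNReal.ofReal (S / s)) /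
              ENNReal.ofReal s := by
  have hnpos : (0 : ℝ) < n := hα.trans hαn
  have hn : n ≠ 0 := by exact_mod_cast hnpos.ne'
  have hp : 0 ≤ α / n := by positivity
  have hc : (2 : ℝ) ≤ 2 ^ n := le_self_pow₀ one_le_two hn
  set K : ℝ≥0∞ := ENNReal.ofReal (2 ^ n * unitBallVolume n ^ (1 - α / n)) with hK
  set q : ℝ≥0∞ := ENNReal.ofReal (2 ^ (-α)) with hq
  have hq1 : q < 1 := by
    rw [hq, ENNReal.ofReal_lt_one]
    exact Real.rpow_lt_one_of_one_lt_of_neg one_lt_two (by linarith)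
  set C : ℝ≥0∞ := 1 + (K * 2 * 2 + K * (1 - q)⁻¹ * (2 ^ n * 2)) with hC
  have hCt : C ≠ ∞ := by
    have h1 : (1 - q)⁻¹ ≠ ∞ := ENNReal.inv_ne_top.2 (tsub_pos_of_lt hq1).ne'
    have h2 : (2 : ℝ≥0∞) ^ n ≠ ∞ := by simp
    finiteness
  have hCcoe : (C.toNNReal : ℝ≥0∞) = C := ENNReal.coe_toNNReal hCt
  refine ⟨C.toNNReal, ?_, ?_⟩
  · rw [← ENNReal.coe_le_coe, hCcoe]
    exact le_self_add
  intro S hS G hG hGS t ht htt x hx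
  rw [hCcoe]
  have hΦt : Φ t ≠ ∞ := hΦ.finite t htt
  have hΦpos : 0 < (Φ t).toReal := ENNReal.toReal_pos (hΦ.pos ht) hΦt
  set U : ℝ := S / (Φ t).toReal with hU
  have hUpos : 0 < U := by positivity
  set V : ℝ := unitBallVolume n with hV
  have hVpos : 0 < V := unitBallVolume_pos n
  set A : ℝ → ℝ≥0∞ := fun s => yInv Φ (ENNReal.ofReal (S / s)) with hA
  have hAanti : ∀ s s', 0 < s → s ≤ s' → A s' ≤ A s := fun s s' hs hss =>
    hΦ.yInv_mono (ENNReal.ofReal_le_ofReal (div_le_div_of_nonneg_left hS.le hs hss))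
  have hAU : A U = t := by
    have h : S / U = (Φ t).toReal := by rw [hU]; field_simp
    rw [hA]
    simp only
    rw [h, ENNReal.ofReal_toReal hΦt, hΦ.yInv_map]
  set I : ℝ≥0∞ := ∫⁻ s in Ioi U, ENNReal.ofReal (s ^ (α / n)) * A s / ENNReal.ofReal s with hI
  set δ : ℝ := (U / V) ^ (1 / (n : ℝ)) with hδ
  have hδpos : 0 < δ := by positivity
  have hδn : δ ^ n * V = U := by
    rw [hδ, ← Real.rpow_natCast, ← Real.rpow_mul (by positivity), one_div_mul_cancel hnpos.ne',
      Real.rpow_one, div_mul_cancel₀ _ hVpos.ne']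
  have hr : ∀ m : ℤ, (2 : ℝ) ^ (m + 1) * δ = 2 * (2 ^ m * δ) := fun m => by
    rw [zpow_add₀ two_ne_zero, zpow_one]; ring
  have hkey : ∀ m : ℤ, ∀ b : ℝ≥0∞,
      ∫⁻ y in closedBall x (2 ^ (m + 1) * δ), G y ≤
        b * volume (closedBall x (2 ^ (m + 1) * δ)) →
      ENNReal.ofReal ((2 ^ m * δ) ^ (α - n)) *
        ∫⁻ y in closedBall x (2 ^ (m + 1) * δ), G y ≤
        K * (b * ENNReal.ofReal (((2 ^ m * δ) ^ n * V) ^ (α / n))) := fun m b hb => by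
    have h := ofReal_rpow_mul_volume_closedBall hn α x (d := 2 ^ m * δ) (by positivity)
    rw [← hr m] at h
    calc _ ≤ ENNReal.ofReal ((2 ^ m * δ) ^ (α - n)) *
          (b * volume (closedBall x (2 ^ (m + 1) * δ))) := mul_le_mul' le_rfl hb
      _ = b * (ENNReal.ofReal ((2 ^ m * δ) ^ (α - n)) *
          volume (closedBall x (2 ^ (m + 1) * δ))) := by ring
      _ = _ := by rw [h]; ring
  have hnear : ∀ m : ℤ, ∫⁻ y in closedBall x (2 ^ (m + 1) * δ), G y ≤
      t * volume (closedBall x (2 ^ (m + 1) * δ)) := fun m => by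
    by_contra! h
    exact hx ⟨_, by positivity, h⟩
  have hfar : ∀ m : ℕ, ENNReal.ofReal ((2 ^ (m : ℤ) * δ) ^ (α - n)) *
      ∫⁻ y in closedBall x (2 ^ ((m : ℤ) + 1) * δ), G y ≤ K * 2 *
        (ENNReal.ofReal ((((2 : ℝ) ^ n) ^ m * U) ^ (α / n)) *
          A (2 ^ n * (((2 : ℝ) ^ n) ^ m * U))) := fun m => by
    have hu : ((2 : ℝ) ^ (m : ℤ) * δ) ^ n * V = ((2 : ℝ) ^ n) ^ m * U := by
      rw [← hδn, zpow_natCast, mul_pow, ← pow_mul, ← pow_mul, mul_comm m n]; ring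
    set w : ℝ := 2 ^ n * (((2 : ℝ) ^ n) ^ m * U) with hw
    have hwpos : 0 < w := by positivity
    have hvol : volume (closedBall x (2 ^ ((m : ℤ) + 1) * δ)) = ENNReal.ofReal w := by
      rw [Eu.volume_closedBall_eq_ofReal x (by positivity), hr, mul_pow, mul_assoc, ← hV, hu]
    have hAw : Φ (A w) = ENNReal.ofReal (S / w) := hΦ.map_yInv _
    have hA0 : A w ≠ 0 := fun h => by
      rw [h, hΦ.map_zero] at hAw
      exact (ENNReal.ofReal_pos.2 (by positivity : 0 < S / w)).ne hAw
    have h := hkey m (2 * A w) (hΦ.setLIntegral_le hA0 (hΦ.yInv_ne_top ENNReal.ofReal_ne_top) <| by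
      rw [hAw, hvol, ← ENNReal.ofReal_mul (by positivity), div_mul_cancel₀ _ hwpos.ne']
      exact hGS)
    rw [hu] at h
    refine h.trans (le_of_eq ?_)
    ring
  have hclose : ∀ j : ℕ, ENNReal.ofReal ((2 ^ (-((j : ℤ) + 1)) * δ) ^ (α - n)) *
      ∫⁻ y in closedBall x (2 ^ (-((j : ℤ) + 1) + 1) * δ), G y ≤
        K * (t * ENNReal.ofReal (U ^ (α / n))) * q ^ j := fun j => by
    refine (hkey _ t (hnear _)).trans ?_
    have hu : ((((2 : ℝ) ^ (-((j : ℤ) + 1)) * δ) ^ n * V) ^ (α / n)) ≤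
        U ^ (α / n) * (2 ^ (-α)) ^ j := by
      rw [mul_pow, mul_assoc, hδn, mul_comm, Real.mul_rpow hUpos.le (by positivity)]
      gcongr
      rw [← Real.rpow_natCast _ n, ← Real.rpow_mul (by positivity), mul_div_cancel₀ _ hnpos.ne',
        ← Real.rpow_intCast, ← Real.rpow_mul (by norm_num), ← Real.rpow_mul_natCast (by norm_num)]
      refine Real.rpow_le_rpow_of_exponent_le one_le_two ?_
      push_cast
      nlinarith
    calc _ ≤ K * (t * ENNReal.ofReal (U ^ (α / n) * (2 ^ (-α)) ^ j)) := by gcongr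
      _ = _ := by
        rw [ENNReal.ofReal_mul (by positivity), ENNReal.ofReal_pow (by positivity)]
        ring
  have htI : t * ENNReal.ofReal (U ^ (α / n)) ≤ 2 ^ n * 2 * I := by
    have h1 : t ≤ 2 ^ n * A (2 ^ n * U) := by
      have h := hΦ.yInv_le_mul_yInv_div (c := 2 ^ n) (one_le_pow₀ one_le_two) (by simp)
        (ENNReal.ofReal (S / U))
      have h2 : ENNReal.ofReal (S / U) / 2 ^ n = ENNReal.ofReal (S / (2 ^ n * U)) := by
        rw [mul_comm, ← div_div, ENNReal.ofReal_div_of_pos (by positivity : (0 : ℝ) < 2 ^ n),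
          ENNReal.ofReal_pow (by norm_num), ENNReal.ofReal_ofNat]
      rw [h2] at h
      exact hAU ▸ h
    have h3 := (mul_le_two_mul_lintegral_Ioc hp hc hUpos hAanti).trans
      (mul_le_mul' (le_refl 2) (lintegral_mono_set Ioc_subset_Ioi_self))
    calc t * ENNReal.ofReal (U ^ (α / n))
        ≤ 2 ^ n * A (2 ^ n * U) * ENNReal.ofReal (U ^ (α / n)) := by gcongr
      _ = 2 ^ n * (ENNReal.ofReal (U ^ (α / n)) * A (2 ^ n * U)) := by ring
      _ ≤ 2 ^ n * (2 * I) := by gcongr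
      _ = _ := by ring
  refine (lintegral_riesz_le_tsum hαn hδpos hG x).trans ?_
  rw [tsum_of_nat_of_neg_add_one ENNReal.summable ENNReal.summable]
  calc _ ≤ K * 2 * (2 * I) + K * (2 ^ n * 2 * I) * (1 - q)⁻¹ := by
        refine add_le_add ?_ ?_
        · refine (ENNReal.tsum_le_tsum hfar).trans ?_
          rw [ENNReal.tsum_mul_left]
          exact mul_le_mul' le_rfl (tsum_mul_le_two_mul_lintegral_Ioi hp hc hUpos hAanti)
        · refine (ENNReal.tsum_le_tsum hclose).trans ?_
          rw [ENNReal.tsum_mul_left, ENNReal.tsum_geometric]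
          gcongr
    _ = (K * 2 * 2 + K * (1 - q)⁻¹ * (2 ^ n * 2)) * I := by ring
    _ ≤ C * I := by
        gcongr
        exact le_add_self

lemma setLIntegral_map_div_le_of_orliczNorm_lt {n : ℕ} {Φ : ℝ≥0∞ → ℝ≥0∞} (hΦ : IsOrliczFn Φ)
    {lam : ℝ} {B : Set (Eu n)} (hB0 : volume B ≠ 0) (hBt : volume B ≠ ∞) {f : Eu n → ℝ}
    {N : ℝ≥0∞} (hN : orliczNorm Φ lam B f < N) :
    ∫⁻ x in B, Φ (‖f x‖₊ / N) ≤ volume B ^ lam := by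
  obtain ⟨ε, ⟨-, -, hε⟩, hεN⟩ := sInf_lt_iff.1 hN
  rw [ENNReal.rpow_neg, mul_comm, ← div_eq_mul_inv] at hε
  have h := (ENNReal.div_le_iff (ENNReal.rpow_pos (pos_iff_ne_zero.2 hB0) hBt).ne'
    (ENNReal.rpow_ne_top_of_ne_zero hB0 hBt)).1 hε
  rw [one_mul] at h
  exact (lintegral_mono fun x => hΦ.strictMono.monotone (ENNReal.div_le_div_left hεN.le _)).trans h

lemma volume_ball_two_mul_rpow_le {n : ℕ} {mu : ℝ} (r : ℝ) (hmu : 0 ≤ mu) (hmu1 : mu ≤ 1) :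
    volume (ball (0 : Eu n) (2 * r)) ^ mu ≤ 2 ^ n * volume (ball (0 : Eu n) r) ^ mu := by
  have h : volume (ball (0 : Eu n) (2 * r)) = 2 ^ n * volume (ball (0 : Eu n) r) := by
    have h := Measure.addHaar_ball_mul_of_pos (volume : Measure (Eu n)) 0 zero_lt_two r
    simpa [ENNReal.ofReal_pow] using h
  rw [h, ENNReal.mul_rpow_of_nonneg _ _ hmu]
  gcongr
  calc ((2 : ℝ≥0∞) ^ n) ^ mu ≤ (2 ^ n) ^ (1 : ℝ) :=
        ENNReal.rpow_le_rpow_of_exponent_le (one_le_pow₀ one_le_two) hmu1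
    _ = 2 ^ n := ENNReal.rpow_one _

/-- Hedberg-type local estimate (Lemma for the sufficiency theorem). -/
theorem statement13 {n : ℕ} (α : ℝ) (hα : 0 < α) (hαn : α < n)
    (Φ Ψ : ℝ≥0∞ → ℝ≥0∞) (hΦ : IsOrliczFn Φ) (hΨ : IsOrliczFn Ψ)
    (hΔ : IsDelta2 (yConj Φ)) (lam mu : ℝ)
    (hlm : (0 < lam ∧ lam < 1 ∧ 0 < mu ∧ mu < 1 ∧ lam ≠ mu) ∨ (lam = 0 ∧ mu = 0))
    (C₅ : ℝ) (hC₅ : 1 ≤ C₅)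
    (h5 : ∀ u : ℝ, 0 < u → ∀ r : ℝ, 0 < r →
      (∫⁻ s in Ioi u,
        ENNReal.ofReal (s ^ (α / n)) * yInv Φ (ENNReal.ofReal (r ^ lam / s)) /
          ENNReal.ofReal s) ≤ ENNReal.ofReal C₅ * yInv Ψ (ENNReal.ofReal (r ^ mu / u))) :
    ∃ C₇ : ℝ, 1 ≤ C₇ ∧ ∀ f : Eu n → ℝ, LocallyIntegrable f volume →
      centralNorm Φ lam f ≠ ∞ → centralNorm Φ lam f ≠ 0 → ∀ r : ℝ, 0 < r →
        (∫⁻ x in ball (0 : Eu n) r,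
          Ψ ((∫⁻ y in ball (0 : Eu n) (2 * r),
                (‖f y‖₊ : ℝ≥0∞) * ENNReal.ofReal (‖x - y‖ ^ (α - n))) /
              (ENNReal.ofReal C₇ * centralNorm Φ lam f))) ≤
          volume (ball (0 : Eu n) r) ^ mu := by
  have hnpos : (0 : ℝ) < n := hα.trans hαn
  have hn : n ≠ 0 := by exact_mod_cast hnpos.ne'
  have hmu : 0 ≤ mu ∧ mu ≤ 1 := by
    rcases hlm with ⟨-, -, h1, h2, -⟩ | ⟨-, rfl⟩
    · exact ⟨h1.le, h2.le⟩
    · simp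
  obtain ⟨k, hk, hk2⟩ := hΦ.exists_nabla_two hΔ
  obtain ⟨C, hC1, hC⟩ := hΦ.exists_lintegral_riesz_le hα hαn
  set Q : ℝ := 2 * 5 ^ n * 2 ^ n with hQ
  have hQ1 : 1 ≤ Q := by
    have h1 : (1 : ℝ) ≤ 5 ^ n := one_le_pow₀ (by norm_num)
    have h2 : (1 : ℝ) ≤ 2 ^ n := one_le_pow₀ (by norm_num)
    have h3 : (1 : ℝ) ≤ 5 ^ n * 2 ^ n := one_le_mul_of_one_le_of_one_le h1 h2
    rw [hQ, mul_assoc]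
    linarith
  have hkR : (2 : ℝ) ≤ k := by exact_mod_cast hk
  have hCR : (1 : ℝ) ≤ C := by exact_mod_cast hC1
  have hC₅0 : 0 < C₅ := by linarith
  refine ⟨4 * k * (C * C₅) * Q, ?_, fun f hf hMt hM0 r hr => ?_⟩
  · have h1 : (1 : ℝ) ≤ 4 * k := by linarith
    exact one_le_mul_of_one_le_of_one_le (one_le_mul_of_one_le_of_one_le h1
      (one_le_mul_of_one_le_of_one_le hCR hC₅)) hQ1
  set M := centralNorm Φ lam f with hM
  set B : Set (Eu n) := ball 0 (2 * r) with hB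
  have hBm : MeasurableSet B := measurableSet_ball
  have hB0 : volume B ≠ 0 := (measure_ball_pos volume _ (by positivity)).ne'
  have hBt : volume B ≠ ∞ := measure_ball_lt_top.ne
  set R : ℝ := (volume B).toReal with hR
  have hRpos : 0 < R := ENNReal.toReal_pos hB0 hBt
  have hRp : ∀ p : ℝ, volume B ^ p = ENNReal.ofReal (R ^ p) := fun p => by
    rw [← ENNReal.ofReal_rpow_of_pos hRpos, hR, ENNReal.ofReal_toReal hBt]
  set S : ℝ := R ^ lam with hS
  have hSpos : 0 < S := Real.rpow_pos_of_pos hRpos _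
  set N : ℝ≥0∞ := 2 * M with hN
  have hN0 : N ≠ 0 := mul_ne_zero two_ne_zero hM0
  have hNt : N ≠ ∞ := ENNReal.mul_ne_top (by simp) hMt
  have hnormN : orliczNorm Φ lam B f < N :=
    lt_of_le_of_lt (le_iSup₂_of_le (2 * r) (mul_pos two_pos hr) le_rfl)
      (by rw [hN, two_mul]; exact ENNReal.lt_add_right hMt hM0)
  have hmod : ∫⁻ x in B, Φ (‖f x‖₊ / N) ≤ ENNReal.ofReal S :=
    (setLIntegral_map_div_le_of_orliczNorm_lt hΦ hB0 hBt hnormN).trans (hRp lam).le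
  have hk0 : (k : ℝ≥0∞) ≠ 0 := by
    have : k ≠ 0 := (zero_lt_two.trans_le hk).ne'
    simpa using this
  have hkt : (k : ℝ≥0∞) ≠ ∞ := by simp
  set L : ℝ≥0∞ := k * 2 with hL
  have hL0 : L ≠ 0 := mul_ne_zero hk0 two_ne_zero
  have hLt : L ≠ ∞ := ENNReal.mul_ne_top hkt (by simp)
  have hL1 : 1 ≤ L := by
    have : (1 : ℝ≥0) ≤ k * 2 := by nlinarith [hk]
    rw [hL]
    exact_mod_cast this
  set G : Eu n → ℝ≥0∞ := B.indicator fun x => (‖f x‖₊ / N) / L with hG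
  have hfm : AEMeasurable fun x => (‖f x‖₊ : ℝ≥0∞) := hf.aestronglyMeasurable.enorm
  have hGm : AEMeasurable G := ((hfm.div_const _).div_const _).indicator hBm
  have hLG : ∫⁻ y, Φ (k * (2 * G y)) ≤ ENNReal.ofReal S := by
    refine le_trans (le_of_eq ?_) hmod
    rw [← lintegral_indicator hBm]
    congr with y
    rw [← mul_assoc, ← hL]
    by_cases hy : y ∈ B
    · simp only [hG, indicator_of_mem hy]
      rw [ENNReal.mul_div_cancel hL0 hLt]
    · simp only [hG, indicator_of_notMem hy, mul_zero, hΦ.map_zero]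
  have hGS : ∫⁻ y, Φ (G y) ≤ ENNReal.ofReal S := by
    refine le_trans (lintegral_mono fun y => hΦ.strictMono.monotone ?_) hLG
    rw [← mul_assoc, ← hL]
    exact le_mul_of_one_le_left' hL1
  have hGfin : ∫⁻ y, G y ≠ ∞ := by
    rw [hG, lintegral_indicator hBm]
    simp only [div_eq_mul_inv]
    rw [lintegral_mul_const' _ _ (ENNReal.inv_ne_top.2 hL0),
      lintegral_mul_const' _ _ (ENNReal.inv_ne_top.2 hN0)]
    have h1 : IntegrableOn f B :=
      (hf.integrableOn_isCompact (isCompact_closedBall 0 (2 * r))).mono_set ball_subset_closedBall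
    exact ENNReal.mul_ne_top (ENNReal.mul_ne_top h1.2.ne (ENNReal.inv_ne_top.2 hN0))
      (ENNReal.inv_ne_top.2 hL0)
  set D : ℝ≥0∞ := C * ENNReal.ofReal C₅ with hD
  have hD0 : D ≠ 0 := by
    have h1 : (C : ℝ≥0∞) ≠ 0 := by
      have : C ≠ 0 := (zero_lt_one.trans_le hC1).ne'
      simpa using this
    exact mul_ne_zero h1 (ENNReal.ofReal_pos.2 hC₅0).ne'
  have hDt : D ≠ ∞ := ENNReal.mul_ne_top (by simp) ENNReal.ofReal_ne_top
  set P : Eu n → ℝ≥0∞ := fun x => ∫⁻ y, G y * ENNReal.ofReal (‖x - y‖ ^ (α - n)) with hP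
  set c : ℝ≥0∞ := ENNReal.ofReal (R ^ mu / S) with hc
  have hRmu : 0 < R ^ mu := Real.rpow_pos_of_pos hRpos _
  have hc0 : c ≠ 0 := (ENNReal.ofReal_pos.2 (div_pos hRmu hSpos)).ne'
  have hpt : ∀ t, t ≠ 0 → t ≠ ∞ → ∀ x ∉ maximalLevelSet G t, Ψ (P x / D) ≤ c * Φ t := by
    intro t ht htt x hx
    have hΦt : Φ t ≠ ∞ := hΦ.finite t htt
    have hΦpos : 0 < (Φ t).toReal := ENNReal.toReal_pos (hΦ.pos ht) hΦt
    have h1 : P x ≤ D * yInv Ψ (ENNReal.ofReal (R ^ mu / (S / (Φ t).toReal))) := by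
      refine (hC S hSpos G hGm hGS t ht htt x hx).trans ?_
      rw [hD, mul_assoc]
      exact mul_le_mul' le_rfl (h5 _ (by positivity) R hRpos)
    refine (hΨ.strictMono.monotone (ENNReal.div_le_of_le_mul' h1)).trans (le_of_eq ?_)
    rw [hΨ.map_yInv, hc]
    nth_rw 2 [← ENNReal.ofReal_toReal hΦt]
    rw [← ENNReal.ofReal_mul (by positivity)]
    congr 1
    field_simp
  have hmain := hΦ.lintegral_le_of_le_off_maximalLevelSet hn hk hk2 hGm hGfin hc0
    ENNReal.ofReal_ne_top hpt
  have hQ0 : ENNReal.ofReal Q ≠ 0 := (ENNReal.ofReal_pos.2 (by linarith)).ne'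
  have hPx : ∀ x, (∫⁻ y in B, (‖f y‖₊ : ℝ≥0∞) * ENNReal.ofReal (‖x - y‖ ^ (α - n))) /
      (ENNReal.ofReal (4 * k * (C * C₅) * Q) * M) = P x / D / ENNReal.ofReal Q := by
    intro x
    have h1 : P x = (∫⁻ y in B, (‖f y‖₊ : ℝ≥0∞) * ENNReal.ofReal (‖x - y‖ ^ (α - n))) / (N * L) := by
      rw [div_eq_mul_inv, ← lintegral_mul_const' _ _
        (ENNReal.inv_ne_top.2 (mul_ne_zero hN0 hL0)), ← lintegral_indicator hBm]
      simp only [hP]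
      congr with y
      by_cases hy : y ∈ B
      · simp only [hG, indicator_of_mem hy, div_eq_mul_inv]
        rw [ENNReal.mul_inv (Or.inl hN0) (Or.inl hNt)]
        ring
      · simp only [hG, indicator_of_notMem hy, zero_mul]
    have h2 : ENNReal.ofReal (4 * k * (C * C₅) * Q) * M = N * L * D * ENNReal.ofReal Q := by
      rw [ENNReal.ofReal_mul (by positivity), ENNReal.ofReal_mul (by positivity),
        ENNReal.ofReal_mul (by positivity), ENNReal.ofReal_mul (by positivity),
        ENNReal.ofReal_coe_nnreal, ENNReal.ofReal_coe_nnreal, ENNReal.ofReal_ofNat, hN, hL, hD]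
      ring
    rw [h1, h2]
    simp only [div_eq_mul_inv]
    rw [ENNReal.mul_inv (Or.inr ENNReal.ofReal_ne_top) (Or.inr hQ0),
      ENNReal.mul_inv (Or.inr hDt) (Or.inr hD0)]
    ring
  calc _ ≤ ∫⁻ x in ball (0 : Eu n) r, Ψ (P x / D) * (ENNReal.ofReal Q)⁻¹ := by
        refine lintegral_mono fun x => ?_
        simp only
        rw [hPx x, ← div_eq_mul_inv]
        exact hΨ.map_div_le (by simpa using hQ1) _
    _ ≤ ∫⁻ x, Ψ (P x / D) * (ENNReal.ofReal Q)⁻¹ := setLIntegral_le_lintegral _ _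
    _ = (∫⁻ x, Ψ (P x / D)) * (ENNReal.ofReal Q)⁻¹ :=
        lintegral_mul_const' _ _ (ENNReal.inv_ne_top.2 hQ0)
    _ ≤ 2 * 5 ^ n * c * ENNReal.ofReal S * (ENNReal.ofReal Q)⁻¹ :=
        mul_le_mul' (hmain.trans (mul_le_mul' le_rfl hLG)) le_rfl
    _ = 2 * 5 ^ n * volume B ^ mu * (ENNReal.ofReal Q)⁻¹ := by
        rw [hRp, mul_assoc _ c, hc, ← ENNReal.ofReal_mul (by positivity),
          div_mul_cancel₀ _ hSpos.ne']
    _ ≤ 2 * 5 ^ n * (2 ^ n * volume (ball (0 : Eu n) r) ^ mu) * (ENNReal.ofReal Q)⁻¹ := by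
        gcongr
        exact volume_ball_two_mul_rpow_le r hmu.1 hmu.2
    _ = volume (ball (0 : Eu n) r) ^ mu * (ENNReal.ofReal Q * (ENNReal.ofReal Q)⁻¹) := by
        have h : ENNReal.ofReal Q = 2 * 5 ^ n * 2 ^ n := by
          rw [hQ, ENNReal.ofReal_mul (by positivity), ENNReal.ofReal_mul (by positivity),
            ENNReal.ofReal_pow (by positivity), ENNReal.ofReal_pow (by positivity)]
          simp
        nth_rw 2 [h]
        ring
    _ = volume (ball (0 : Eu n) r) ^ mu := by
        rw [ENNReal.mul_inv_cancel hQ0 ENNReal.ofReal_ne_top, mul_one]
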